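/- The modulational-instability index i₄ of the full-dispersion Camassa–Holm equation without surface tension possesses a root k_c in the open interval (1.41, 1.43) with i₄(k_c) = 0, and moreover i₄(k) > 0 for 0 < k < k_c and i₄(k) < 0 for k > k_c; hence a sufficiently small 2π/k-periodic traveling wave is modulationally unstable precisely when k > k_c = 1.420…. -/

import Mathlib

open Real Filter Set Topology

/-- The water-wave phase speed without surface tension: `c_ww(k;0) = sqrt(tanh k / k)`
for `k ≠ 0`, extended by `c_ww(0;0) = 1`. -/
noncomputable def cww0 (k : ℝ) : ℝ := if k = 0 then 1 else Real.sqrt (Real.tanh k / k)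

/-- `i₁(k) = (k c_ww(k;0))''`, the second derivative of `k ↦ sqrt(k tanh k)`. -/
noncomputable def i1 (k : ℝ) : ℝ :=
  deriv (deriv fun k : ℝ => Real.sqrt (k * Real.tanh k)) k

/-- `i₂(k) = (k c_ww(k;0))' − 1`. -/
noncomputable def i2 (k : ℝ) : ℝ :=
  deriv (fun k : ℝ => Real.sqrt (k * Real.tanh k)) k - 1

/-- `i₃(k) = c_ww(k;0) − c_ww(2k;0)`. -/
noncomputable def i3 (k : ℝ) : ℝ := cww0 k - cww0 (2 * k)

/-- The fourth modulational-instability index of the full-dispersion Camassa–Holm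
equation without surface tension. -/
noncomputable def i4 (k : ℝ) : ℝ :=
  3 * i2 k - i2 k * i3 k + 6 * i3 k - 1 / 12 * k ^ 2 * (57 * i2 k + 34 * i3 k) +
    1 / 108 * k ^ 4 * (198 * i2 k + 35 * i3 k)

theorem hasDerivAt_tanh (x : ℝ) : HasDerivAt Real.tanh (1 - Real.tanh x ^ 2) x := by
  have h := (Real.hasDerivAt_sinh x).div (Real.hasDerivAt_cosh x) (Real.cosh_pos x).ne'
  have hf : Real.tanh = Real.sinh / Real.cosh := by
    ext y
    simp [Real.tanh_eq_sinh_div_cosh]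
  rw [hf]
  refine h.congr_deriv ?_
  have := (Real.cosh_pos x).ne'
  simp only [Pi.div_apply]
  field_simp

theorem tanh_monotone : Monotone Real.tanh :=
  monotone_of_hasDerivAt_nonneg hasDerivAt_tanh fun x => by
    have := Real.tanh_sq_lt_one x
    simp only [Pi.zero_apply]
    linarith

theorem tanh_sub_tanh_le {x y : ℝ} (h : x ≤ y) : Real.tanh y - Real.tanh x ≤ y - x := by
  have hm : Monotone fun t => t - Real.tanh t :=
    monotone_of_hasDerivAt_nonneg (fun t => (hasDerivAt_id t).sub (hasDerivAt_tanh t)) fun t => by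
      simp only [Pi.zero_apply]
      nlinarith [sq_nonneg (Real.tanh t)]
  have := hm h
  simp only at this
  linarith

theorem tanh_pos {x : ℝ} (hx : 0 < x) : 0 < Real.tanh x := by
  rw [Real.tanh_eq_sinh_div_cosh]
  exact div_pos (Real.sinh_pos_iff.2 hx) (Real.cosh_pos x)

theorem tanh_two_mul (x : ℝ) :
    Real.tanh (2 * x) = 2 * Real.tanh x / (1 + Real.tanh x ^ 2) := by
  have h := (Real.cosh_pos x).ne'
  rw [Real.tanh_eq_sinh_div_cosh, Real.tanh_eq_sinh_div_cosh, Real.sinh_two_mul, Real.cosh_two_mul]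
  have h2 : Real.cosh x ^ 2 + Real.sinh x ^ 2 ≠ 0 := by positivity
  field_simp

/-- A function vanishing at `0` whose derivative is `x * g x` with `g > 0` is positive. -/
theorem pos_of_hasDerivAt_mul_pos {f g : ℝ → ℝ} (h0 : f 0 = 0)
    (hf : ∀ x, HasDerivAt f (x * g x) x) (hg : ∀ x, 0 < x → 0 < g x) {x : ℝ} (hx : 0 < x) :
    0 < f x := by
  have hm : StrictMonoOn f (Ici 0) :=
    strictMonoOn_of_hasDerivWithinAt_pos (convex_Ici 0)
      (fun y _ => (hf y).continuousAt.continuousWithinAt)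
      (fun y _ => (hf y).hasDerivWithinAt) fun y hy => by
        rw [interior_Ici] at hy
        exact mul_pos hy (hg y hy)
  simpa [h0] using hm self_mem_Ici hx.le hx

theorem sinh_lt_mul_cosh {x : ℝ} (hx : 0 < x) : 0 < x * Real.cosh x - Real.sinh x := by
  refine pos_of_hasDerivAt_mul_pos (f := fun x => x * Real.cosh x - Real.sinh x)
    (g := Real.sinh) (by simp) (fun x => ?_) (fun x hx => Real.sinh_pos_iff.2 hx) hx
  refine (((hasDerivAt_id x).mul (Real.hasDerivAt_cosh x)).sub (Real.hasDerivAt_sinh x)).congr_deriv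
    ?_
  simp

theorem sinh_cosh_pade_two {x : ℝ} (hx : 0 < x) :
    0 < (3 + x ^ 2) * Real.sinh x - 3 * x * Real.cosh x := by
  refine pos_of_hasDerivAt_mul_pos
    (f := fun x => (3 + x ^ 2) * Real.sinh x - 3 * x * Real.cosh x)
    (g := fun x => x * Real.cosh x - Real.sinh x) (by simp) (fun x => ?_)
    (fun x hx => sinh_lt_mul_cosh hx) hx
  refine (((((hasDerivAt_id x).pow 2).const_add 3).mul (Real.hasDerivAt_sinh x)).sub
    (((hasDerivAt_id x).const_mul 3).mul (Real.hasDerivAt_cosh x))).congr_deriv ?_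
  simp
  ring

theorem sinh_cosh_pade_three {x : ℝ} (hx : 0 < x) :
    0 < (15 * x + x ^ 3) * Real.cosh x - (15 + 6 * x ^ 2) * Real.sinh x := by
  refine pos_of_hasDerivAt_mul_pos
    (f := fun x => (15 * x + x ^ 3) * Real.cosh x - (15 + 6 * x ^ 2) * Real.sinh x)
    (g := fun x => (3 + x ^ 2) * Real.sinh x - 3 * x * Real.cosh x) (by simp) (fun x => ?_)
    (fun x hx => sinh_cosh_pade_two hx) hx
  refine (((((hasDerivAt_id x).const_mul 15).add ((hasDerivAt_id x).pow 3)).mul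
    (Real.hasDerivAt_cosh x)).sub (((((hasDerivAt_id x).pow 2).const_mul 6).const_add 15).mul
    (Real.hasDerivAt_sinh x))).congr_deriv ?_
  simp
  ring

theorem sinh_cosh_pade_four {x : ℝ} (hx : 0 < x) :
    0 < (105 + 45 * x ^ 2 + x ^ 4) * Real.sinh x - (105 * x + 10 * x ^ 3) * Real.cosh x := by
  refine pos_of_hasDerivAt_mul_pos
    (f := fun x => (105 + 45 * x ^ 2 + x ^ 4) * Real.sinh x - (105 * x + 10 * x ^ 3) * Real.cosh x)
    (g := fun x => (15 * x + x ^ 3) * Real.cosh x - (15 + 6 * x ^ 2) * Real.sinh x) (by simp)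
    (fun x => ?_) (fun x hx => sinh_cosh_pade_three hx) hx
  refine ((((((hasDerivAt_id x).pow 2).const_mul 45).const_add 105).add
    ((hasDerivAt_id x).pow 4)).mul (Real.hasDerivAt_sinh x)).sub
    ((((hasDerivAt_id x).const_mul 105).add (((hasDerivAt_id x).pow 3).const_mul 10)).mul
    (Real.hasDerivAt_cosh x)) |>.congr_deriv ?_
  simp
  ring

theorem tanh_lt_self {x : ℝ} (hx : 0 < x) : Real.tanh x < x := by
  rw [Real.tanh_eq_sinh_div_cosh, div_lt_iff₀ (Real.cosh_pos x)]
  linarith [sinh_lt_mul_cosh hx]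

theorem pade_two_lt_tanh {x : ℝ} (hx : 0 < x) : 3 * x / (3 + x ^ 2) < Real.tanh x := by
  rw [Real.tanh_eq_sinh_div_cosh, div_lt_div_iff₀ (by positivity) (Real.cosh_pos x)]
  linarith [sinh_cosh_pade_two hx]

theorem tanh_lt_pade_three {x : ℝ} (hx : 0 < x) :
    Real.tanh x < (15 * x + x ^ 3) / (15 + 6 * x ^ 2) := by
  rw [Real.tanh_eq_sinh_div_cosh, div_lt_div_iff₀ (Real.cosh_pos x) (by positivity)]
  linarith [sinh_cosh_pade_three hx]

theorem pade_four_lt_tanh {x : ℝ} (hx : 0 < x) :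
    (105 * x + 10 * x ^ 3) / (105 + 45 * x ^ 2 + x ^ 4) < Real.tanh x := by
  rw [Real.tanh_eq_sinh_div_cosh, div_lt_div_iff₀ (by positivity) (Real.cosh_pos x)]
  linarith [sinh_cosh_pade_four hx]

theorem one_sub_tanh_mul (x : ℝ) : (1 - Real.tanh x) * (Real.exp (2 * x) + 1) = 2 := by
  rw [Real.tanh_eq, two_mul, Real.exp_add, Real.exp_neg]
  field_simp
  ring

theorem one_lt_tanh_mul {x : ℝ} (hx : 0 < x) : x < Real.tanh x * (1 + x) := by
  have h := one_sub_tanh_mul x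
  have h1 : 2 * x + 1 < Real.exp (2 * x) := Real.add_one_lt_exp (by positivity)
  have h2 := Real.tanh_lt_one x
  nlinarith

theorem two_mul_le_tanh_mul {x : ℝ} (hx : 1 ≤ x) : 2 * x ≤ Real.tanh x * (1 + 2 * x) := by
  have h := one_sub_tanh_mul x
  have h1 := Real.quadratic_le_exp_of_nonneg (x := 2 * x) (by positivity)
  have h2 := Real.tanh_lt_one x
  have h3 : 4 * x + 1 ≤ Real.exp (2 * x) := by nlinarith
  nlinarith

theorem antitoneOn_tanh_div : AntitoneOn (fun x : ℝ => Real.tanh x / x) (Ioi 0) := by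
  have hd : ∀ x ∈ Ioi (0 : ℝ), HasDerivAt (fun x : ℝ => Real.tanh x / x)
      (((1 - Real.tanh x ^ 2) * x - Real.tanh x * 1) / x ^ 2) x := fun x hx =>
    (hasDerivAt_tanh x).div (hasDerivAt_id x) (ne_of_gt hx)
  refine antitoneOn_of_hasDerivWithinAt_nonpos (convex_Ioi 0)
    (fun x hx => (hd x hx).continuousAt.continuousWithinAt)
    (fun x hx => (hd x (by simpa using hx)).hasDerivWithinAt) fun x hx => ?_
  rw [interior_Ioi] at hx
  have hx0 : 0 < x := hx
  refine div_nonpos_of_nonpos_of_nonneg ?_ (by positivity)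
  have hc := Real.cosh_pos x
  have h : 2 * x ≤ Real.sinh (2 * x) := Real.self_le_sinh_iff.2 (by positivity)
  rw [Real.sinh_two_mul] at h
  have he : (1 - Real.tanh x ^ 2) * x - Real.tanh x * 1 =
      (x - Real.sinh x * Real.cosh x) / Real.cosh x ^ 2 := by
    rw [Real.tanh_eq_sinh_div_cosh]
    field_simp
    linear_combination x * Real.cosh_sq x
  rw [he]
  exact div_nonpos_of_nonpos_of_nonneg (by linarith) (by positivity)

theorem cww0_of_pos {k : ℝ} (hk : 0 < k) : cww0 k = √(Real.tanh k / k) := if_neg hk.ne'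

theorem cww0_pos {k : ℝ} (hk : 0 < k) : 0 < cww0 k := by
  rw [cww0_of_pos hk]
  exact Real.sqrt_pos.2 (div_pos (tanh_pos hk) hk)

theorem cww0_sq {k : ℝ} (hk : 0 < k) : cww0 k ^ 2 = Real.tanh k / k := by
  rw [cww0_of_pos hk, Real.sq_sqrt (div_pos (tanh_pos hk) hk).le]

theorem tanh_eq_mul_cww0_sq {k : ℝ} (hk : 0 < k) : Real.tanh k = k * cww0 k ^ 2 := by
  rw [cww0_sq hk]
  field_simp

theorem cww0_lt_one {k : ℝ} (hk : 0 < k) : cww0 k < 1 := by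
  have h : cww0 k ^ 2 < 1 := by
    rw [cww0_sq hk, div_lt_one hk]
    exact tanh_lt_self hk
  have := cww0_pos hk
  nlinarith

theorem cww0_anti {x y : ℝ} (hx : 0 < x) (h : x ≤ y) : cww0 y ≤ cww0 x := by
  rw [cww0_of_pos hx, cww0_of_pos (hx.trans_le h)]
  exact Real.sqrt_le_sqrt (antitoneOn_tanh_div hx (hx.trans_le h) h)

/-- The ratio `c_ww(k;0) / c_ww(2k;0)`, see `cww0_two_mul`. -/
noncomputable def doublingRatio (k : ℝ) : ℝ := √(1 + Real.tanh k ^ 2)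

theorem doublingRatio_sq (k : ℝ) : doublingRatio k ^ 2 = 1 + Real.tanh k ^ 2 :=
  Real.sq_sqrt (by positivity)

theorem one_le_doublingRatio (k : ℝ) : 1 ≤ doublingRatio k :=
  Real.one_le_sqrt.2 (by nlinarith [sq_nonneg (Real.tanh k)])

theorem doublingRatio_mono {x y : ℝ} (hx : 0 < x) (h : x ≤ y) :
    doublingRatio x ≤ doublingRatio y := by
  have h1 := tanh_monotone h
  have h2 := tanh_pos hx
  exact Real.sqrt_le_sqrt (by nlinarith)

theorem cww0_two_mul {k : ℝ} (hk : 0 < k) : cww0 (2 * k) = cww0 k / doublingRatio k := by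
  rw [cww0_of_pos hk, cww0_of_pos (by positivity), doublingRatio,
    ← Real.sqrt_div' _ (by positivity), tanh_two_mul]
  congr 1
  field_simp

theorem i2_eq {k : ℝ} (hk : 0 < k) :
    i2 k = -(Real.tanh k ^ 2 - (1 - cww0 k) ^ 2) / (2 * cww0 k) := by
  have hT := tanh_pos hk
  have hc := cww0_pos hk
  have hd : HasDerivAt (fun x => √(x * Real.tanh x)) _ k :=
    ((hasDerivAt_id k).mul (hasDerivAt_tanh k)).sqrt (by simpa using (mul_pos hk hT).ne')
  have hs : √(k * Real.tanh k) = k * cww0 k := by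
    rw [Real.sqrt_eq_iff_mul_self_eq (by positivity) (by positivity), tanh_eq_mul_cww0_sq hk]
    ring
  rw [i2, HasDerivAt.deriv hd]
  simp only [Pi.mul_apply, id_eq, hs]
  have h := tanh_eq_mul_cww0_sq hk
  field_simp
  linear_combination h

theorem i3_eq {k : ℝ} (hk : 0 < k) :
    i3 k = cww0 k * Real.tanh k ^ 2 / (doublingRatio k * (doublingRatio k + 1)) := by
  have hs := one_le_doublingRatio k
  have hs2 := doublingRatio_sq k
  rw [i3, cww0_two_mul hk]
  field_simp
  linear_combination cww0 k * hs2

/-- The coefficient of `i₂` in `i₄`. -/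
noncomputable def i2Coeff (k : ℝ) : ℝ := 3 - 19 / 4 * k ^ 2 + 11 / 6 * k ^ 4

/-- The coefficient of `i₃` in `i₄`. -/
noncomputable def i3Coeff (k : ℝ) : ℝ := 6 - 17 / 6 * k ^ 2 + 35 / 108 * k ^ 4

/-- The index `i₄` up to the positive factor `tanh² k / (2 c_ww(k;0))`. -/
noncomputable def reducedIndex (k : ℝ) : ℝ :=
  -(i2Coeff k * (1 - ((1 - cww0 k) / Real.tanh k) ^ 2)) +
    (2 * i3Coeff k * cww0 k ^ 2 + cww0 k * (Real.tanh k ^ 2 - (1 - cww0 k) ^ 2)) /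
      (doublingRatio k * (doublingRatio k + 1))

theorem i4_eq {k : ℝ} (hk : 0 < k) :
    i4 k = Real.tanh k ^ 2 / (2 * cww0 k) * reducedIndex k := by
  have hT := tanh_pos hk
  have hc := cww0_pos hk
  have hs := one_le_doublingRatio k
  rw [i4, reducedIndex, i2_eq hk, i3_eq hk, i2Coeff, i3Coeff]
  field_simp
  ring

theorem i4_pos_iff {k : ℝ} (hk : 0 < k) : 0 < i4 k ↔ 0 < reducedIndex k := by
  have hT := tanh_pos hk
  have hc := cww0_pos hk
  rw [i4_eq hk, mul_pos_iff_of_pos_left (by positivity)]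

theorem i4_neg_iff {k : ℝ} (hk : 0 < k) : i4 k < 0 ↔ reducedIndex k < 0 := by
  have hT := tanh_pos hk
  have hc := cww0_pos hk
  rw [i4_eq hk, ← neg_pos, ← mul_neg, mul_pos_iff_of_pos_left (by positivity), neg_pos]

theorem one_sub_cww0_lt_tanh {k : ℝ} (hk : 0 < k) : 1 - cww0 k < Real.tanh k := by
  have h := one_lt_tanh_mul hk
  have h1 := cww0_sq hk
  have h2 := cww0_pos hk
  have h3 := cww0_lt_one hk
  have h4 : 1 - Real.tanh k < cww0 k ^ 2 := by
    rw [h1, lt_div_iff₀ hk]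
    linarith
  nlinarith

theorem three_le_cww0_sq_mul {k : ℝ} (hk : 0 < k) : 3 ≤ cww0 k ^ 2 * (3 + k ^ 2) := by
  have h := (pade_two_lt_tanh hk).le
  rw [tanh_eq_mul_cww0_sq hk, div_le_iff₀ (by positivity)] at h
  refine le_of_mul_le_mul_left ?_ hk
  linarith

theorem sq_one_sub_cww0_lt {k : ℝ} (hk : 0 < k) : (1 - cww0 k) ^ 2 < Real.tanh k ^ 2 := by
  have h1 := one_sub_cww0_lt_tanh hk
  have h2 := cww0_lt_one hk
  exact pow_lt_pow_left₀ h1 (by linarith) two_ne_zero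

theorem ratio_sq_lt_one {k : ℝ} (hk : 0 < k) : ((1 - cww0 k) / Real.tanh k) ^ 2 < 1 := by
  rw [div_pow, div_lt_one (pow_pos (tanh_pos hk) 2)]
  exact sq_one_sub_cww0_lt hk

theorem reducedIndex_pos_of_sq_le {k : ℝ} (hk : 0 < k) (h : k ^ 2 ≤ 3 / 2) :
    0 < reducedIndex k := by
  have hT := tanh_pos hk
  have hTk := tanh_lt_self hk
  have hc := cww0_pos hk
  have hs := one_le_doublingRatio k
  have hs2 := doublingRatio_sq k
  have hp := ratio_sq_lt_one hk
  have hp0 := sq_nonneg ((1 - cww0 k) / Real.tanh k)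
  have hq := mul_pos hc (sub_pos.2 (sq_one_sub_cww0_lt hk))
  have hB : 0 < i3Coeff k := by
    rw [i3Coeff]
    nlinarith [sq_nonneg (k ^ 2)]
  have hss : 0 < doublingRatio k * (doublingRatio k + 1) := by positivity
  rw [reducedIndex]
  rcases le_or_gt (i2Coeff k) 0 with hA | hA
  · have h1 := mul_nonneg (neg_nonneg.2 hA) (sub_nonneg.2 hp.le)
    have h2 : 0 < (2 * i3Coeff k * cww0 k ^ 2 +
        cww0 k * (Real.tanh k ^ 2 - (1 - cww0 k) ^ 2)) /
          (doublingRatio k * (doublingRatio k + 1)) := by positivity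
    linarith
  · have hk2 : k ^ 2 < 12 / 11 := by
      by_contra! hcon
      rw [i2Coeff] at hA
      nlinarith [mul_nonneg (sub_nonneg.2 hcon) (sub_nonneg.2 h)]
    have hTy : Real.tanh k ^ 2 ≤ k ^ 2 := pow_le_pow_left₀ hT.le hTk.le 2
    have hs3 : doublingRatio k ≤ 1 + k ^ 2 / 2 := by
      refine abs_le_of_sq_le_sq' ?_ (by positivity) |>.2
      nlinarith [sq_nonneg (k ^ 2)]
    have hden : doublingRatio k * (doublingRatio k + 1) ≤ 2 + 3 / 2 * k ^ 2 := by nlinarith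
    have hc2 := three_le_cww0_sq_mul hk
    have hpoly : i2Coeff k * (2 + 3 / 2 * k ^ 2) * (3 + k ^ 2) < 6 * i3Coeff k := by
      rw [i2Coeff, i3Coeff]
      have hy : 0 < k ^ 2 := by positivity
      generalize hyd : k ^ 2 = y at *
      have : k ^ 4 = y ^ 2 := by rw [← hyd]; ring
      rw [this]
      nlinarith [mul_pos hy (sub_pos.2 hk2), mul_pos (mul_pos hy hy) (sub_pos.2 hk2),
        mul_pos (mul_pos (mul_pos hy hy) hy) (sub_pos.2 hk2)]
    have h3 : i2Coeff k * (2 + 3 / 2 * k ^ 2) < 2 * i3Coeff k * cww0 k ^ 2 := by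
      refine lt_of_mul_lt_mul_right ?_ (by positivity : 0 ≤ 3 + k ^ 2)
      nlinarith [mul_le_mul_of_nonneg_left hc2 hB.le]
    have h4 : i2Coeff k < (2 * i3Coeff k * cww0 k ^ 2 +
        cww0 k * (Real.tanh k ^ 2 - (1 - cww0 k) ^ 2)) /
          (doublingRatio k * (doublingRatio k + 1)) := by
      rw [lt_div_iff₀ hss]
      nlinarith [mul_le_mul_of_nonneg_left hden hA.le]
    nlinarith [mul_nonneg hA.le hp0]

theorem reducedIndex_neg_of_le_sq {k : ℝ} (hk : 0 < k) (h : 18 / 5 ≤ k ^ 2) :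
    reducedIndex k < 0 := by
  have hT := tanh_pos hk
  have hT1 := Real.tanh_lt_one k
  have hc := cww0_pos hk
  have hc1 := cww0_lt_one hk
  have hs := one_le_doublingRatio k
  have hp := ratio_sq_lt_one hk
  have hss : 2 ≤ doublingRatio k * (doublingRatio k + 1) := by nlinarith
  have hss0 : 0 < doublingRatio k * (doublingRatio k + 1) := by linarith
  set p := ((1 - cww0 k) / Real.tanh k) ^ 2 with hpdef
  have hpT : Real.tanh k ^ 2 - (1 - cww0 k) ^ 2 = Real.tanh k ^ 2 * (1 - p) := by
    rw [hpdef]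
    field_simp
  have hpos : 0 < 1 - p := by linarith
  have hy : k ^ 4 = (k ^ 2) ^ 2 := by ring
  have hlast : cww0 k * (Real.tanh k ^ 2 - (1 - cww0 k) ^ 2) ≤ 1 - p := by
    rw [hpT, ← mul_assoc]
    refine mul_le_of_le_one_left hpos.le ?_
    nlinarith
  have hA : 8 < i2Coeff k := by
    rw [i2Coeff, hy]
    nlinarith
  rw [reducedIndex, ← hpdef, neg_add_lt_iff_lt_add, add_zero, div_lt_iff₀ hss0]
  have hA2 : 2 * (i2Coeff k * (1 - p)) ≤
      i2Coeff k * (1 - p) * (doublingRatio k * (doublingRatio k + 1)) := by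
    rw [mul_comm 2]
    exact mul_le_mul_of_nonneg_left hss (by positivity)
  refine lt_of_lt_of_le ?_ hA2
  rcases le_or_gt (i3Coeff k) 0 with hB | hB
  · nlinarith [mul_nonneg (neg_nonneg.2 hB) (sq_nonneg (cww0 k))]
  · have hk2 : 36 / 7 < k ^ 2 := by
      by_contra! hcon
      rw [i3Coeff, hy] at hB
      nlinarith [mul_nonneg (sub_nonneg.2 h) (sub_nonneg.2 hcon)]
    have hk1 : 1 ≤ k := by nlinarith
    have hthalf : 1 - Real.tanh k ≤ cww0 k ^ 2 / 2 := by
      have h1 := two_mul_le_tanh_mul hk1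
      rw [cww0_sq hk, div_div, le_div_iff₀ (by positivity)]
      linarith
    have hpc : cww0 k / 2 ≤ 1 - p := by
      have hr : (1 - cww0 k) / Real.tanh k ≤ 1 - cww0 k / 2 := by
        rw [div_le_iff₀ hT]
        nlinarith
      have hr0 : 0 ≤ (1 - cww0 k) / Real.tanh k := div_nonneg (by linarith) hT.le
      nlinarith
    have hAB : 2 * i3Coeff k < i2Coeff k - 1 / 2 := by
      rw [i2Coeff, i3Coeff, hy]
      nlinarith
    have h1 : i3Coeff k * cww0 k ^ 2 ≤ i3Coeff k * cww0 k * 1 := by nlinarith [mul_pos hB hc]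
    have h2 : (i2Coeff k - 1 / 2) * (cww0 k / 2) ≤ (i2Coeff k - 1 / 2) * (1 - p) :=
      mul_le_mul_of_nonneg_left hpc (by linarith)
    have h3 := mul_lt_mul_of_pos_right hAB hc
    linarith

theorem cww0_sub_le {x z : ℝ} (hx : 0 < x) (h : x ≤ z) :
    z * (cww0 x - cww0 z) ≤ cww0 x * (z - x) := by
  have hz := hx.trans_le h
  have hcx := cww0_pos hx
  have hcz := cww0_pos hz
  have hT := tanh_monotone h
  rw [tanh_eq_mul_cww0_sq hx, tanh_eq_mul_cww0_sq hz] at hT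
  have h1 : x * cww0 x ≤ z * cww0 z := by
    refine abs_le_of_sq_le_sq' ?_ (by positivity) |>.2
    nlinarith [mul_le_mul_of_nonneg_left hT hz.le, mul_le_mul_of_nonneg_right h hx.le,
      mul_nonneg (mul_nonneg hx.le (sub_nonneg.2 h)) (sq_nonneg (cww0 x))]
  linarith

theorem two_thirds_lt_cww0 {k : ℝ} (hk : 0 < k) (h : k ^ 2 ≤ 18 / 5) : 2 / 3 < cww0 k := by
  have h1 := three_le_cww0_sq_mul hk
  have h2 := cww0_pos hk
  by_contra! hcon
  nlinarith

theorem four_fifths_lt_tanh {k : ℝ} (hk : 0 < k) (h : 3 / 2 ≤ k ^ 2) : 4 / 5 < Real.tanh k := by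
  have h1 : (1.22 : ℝ) ≤ k := by nlinarith
  have h2 := pade_two_lt_tanh (x := 1.22) (by norm_num)
  have h3 := tanh_monotone h1
  norm_num at h2 h3 ⊢
  linarith

theorem i2Coeff_nonneg {k : ℝ} (h : 3 / 2 ≤ k ^ 2) : 0 ≤ i2Coeff k := by
  have hk : i2Coeff k = 11 / 6 * ((k ^ 2 - 12 / 11) * (k ^ 2 - 3 / 2)) := by
    rw [i2Coeff]
    ring
  rw [hk]
  have := mul_nonneg (by linarith : 0 ≤ k ^ 2 - 12 / 11) (sub_nonneg.2 h)
  linarith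

theorem i2Coeff_le {k : ℝ} (h : 3 / 2 ≤ k ^ 2) (h' : k ^ 2 ≤ 18 / 5) :
    i2Coeff k ≤ 23 / 5 * (k ^ 2 - 3 / 2) := by
  have hk : i2Coeff k = 11 / 6 * (k ^ 2 - 12 / 11) * (k ^ 2 - 3 / 2) := by
    rw [i2Coeff]
    ring
  rw [hk]
  exact mul_le_mul_of_nonneg_right (by linarith) (sub_nonneg.2 h)

theorem slope_mul_le_i2Coeff_sub {x z : ℝ} (hx : 0 < x) (hx2 : 3 / 2 ≤ x ^ 2) (hxz : x ≤ z) :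
    2 * x * (11 / 3 * x ^ 2 - 19 / 4) * (z - x) ≤ i2Coeff z - i2Coeff x := by
  have hxz2 : x ^ 2 ≤ z ^ 2 := pow_le_pow_left₀ hx.le hxz 2
  have : i2Coeff z - i2Coeff x = (z + x) * (11 / 6 * (z ^ 2 + x ^ 2) - 19 / 4) * (z - x) := by
    rw [i2Coeff, i2Coeff]
    ring
  rw [this]
  refine mul_le_mul_of_nonneg_right ?_ (sub_nonneg.2 hxz)
  exact mul_le_mul (by linarith) (by linarith) (by linarith) (by linarith)

theorem i3Coeff_nonneg {k : ℝ} (h : k ^ 2 ≤ 18 / 5) : 0 ≤ i3Coeff k := by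
  have hk : i3Coeff k = 35 / 108 * ((18 / 5 - k ^ 2) * (36 / 7 - k ^ 2)) := by
    rw [i3Coeff]
    ring
  rw [hk]
  have := mul_nonneg (sub_nonneg.2 h) (by linarith : 0 ≤ 36 / 7 - k ^ 2)
  linarith

theorem i3Coeff_anti {x z : ℝ} (hxz : x ^ 2 ≤ z ^ 2) (hz : z ^ 2 ≤ 18 / 5) :
    i3Coeff z ≤ i3Coeff x := by
  have h : i3Coeff x - i3Coeff z =
      (z ^ 2 - x ^ 2) * (17 / 6 - 35 / 108 * (z ^ 2 + x ^ 2)) := by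
    rw [i3Coeff, i3Coeff]
    ring
  have := mul_nonneg (sub_nonneg.2 hxz)
    (by linarith : 0 ≤ 17 / 6 - 35 / 108 * (z ^ 2 + x ^ 2))
  linarith

theorem sub_lt_i2_term_sub {x z : ℝ} (hx : 0 < x) (hx2 : 3 / 2 ≤ x ^ 2) (hxz : x < z)
    (hz2 : z ^ 2 ≤ 18 / 5) :
    z - x < i2Coeff z * (1 - ((1 - cww0 z) / Real.tanh z) ^ 2) -
      i2Coeff x * (1 - ((1 - cww0 x) / Real.tanh x) ^ 2) := by
  have hz := hx.trans hxz
  have hxz2 : x ^ 2 ≤ z ^ 2 := pow_le_pow_left₀ hx.le hxz.le 2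
  have hx1 : 1.22 < x := by nlinarith
  have hTx := four_fifths_lt_tanh hx hx2
  have hTz := four_fifths_lt_tanh hz (hx2.trans hxz2)
  have hTm := tanh_monotone hxz.le
  have hcz := two_thirds_lt_cww0 hz hz2
  have hcm := cww0_anti hx hxz.le
  have hcx1 := cww0_lt_one hx
  have hcl := cww0_sub_le hx hxz.le
  have hd : 0 < z - x := sub_pos.2 hxz
  have hAx := i2Coeff_nonneg hx2
  have hAx' := i2Coeff_le hx2 (hxz2.trans hz2)
  have hAm := slope_mul_le_i2Coeff_sub hx hx2 hxz.le
  have hpx0 : 0 ≤ (1 - cww0 x) / Real.tanh x := div_nonneg (by linarith) (by linarith)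
  have hpz : (1 - cww0 z) / Real.tanh z ≤ 5 / 12 := by
    rw [div_le_iff₀ (by linarith)]
    linarith
  have hpm : (1 - cww0 z) / Real.tanh z ≤ (1 - cww0 x) / Real.tanh x + 5 / 4 * (z - x) := by
    have h1 : (1 - cww0 z) / Real.tanh z ≤ (1 - cww0 z) / Real.tanh x :=
      div_le_div_of_nonneg_left (by linarith) (by linarith) hTm
    refine h1.trans ?_
    rw [← sub_le_iff_le_add', ← sub_div, div_le_iff₀ (by linarith)]
    have h2 : cww0 x - cww0 z ≤ z - x := by nlinarith
    nlinarith
  have hpz0 : 0 ≤ (1 - cww0 z) / Real.tanh z := div_nonneg (by linarith) (by linarith)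
  set px := (1 - cww0 x) / Real.tanh x
  set pz := (1 - cww0 z) / Real.tanh z
  have hp1 : pz ^ 2 - px ^ 2 ≤ 25 / 24 * (z - x) := by
    rcases le_total pz px with h1 | h1
    · linarith [pow_le_pow_left₀ hpz0 h1 2]
    · have h2 : (pz - px) * (pz + px) ≤ 5 / 4 * (z - x) * (5 / 6) :=
        mul_le_mul (by linarith) (by linarith) (by linarith) (by linarith)
      linarith
  have hp2 : pz ^ 2 ≤ 25 / 144 := by nlinarith
  have h1 := mul_le_mul_of_nonneg_left hp1 hAx
  have hslope : 1 < 119 / 144 * (2 * x * (11 / 3 * x ^ 2 - 19 / 4)) - 25 / 24 * i2Coeff x := by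
    have h2 : 2.44 * (11 / 3 * x ^ 2 - 19 / 4) ≤ 2 * x * (11 / 3 * x ^ 2 - 19 / 4) :=
      mul_le_mul_of_nonneg_right (by linarith) (by linarith)
    linarith
  have h4 := mul_lt_mul_of_pos_right hslope hd
  have h5 : 0 ≤ i2Coeff z - i2Coeff x :=
    le_trans (mul_nonneg (mul_nonneg (by linarith) (by linarith)) hd.le) hAm
  have h6 := mul_le_mul_of_nonneg_left hp2 h5
  linarith

theorem i3_term_sub_le {x z : ℝ} (hx : 0 < x) (hxz : x ≤ z) (hz2 : z ^ 2 ≤ 18 / 5) :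
    (2 * i3Coeff z * cww0 z ^ 2 + cww0 z * (Real.tanh z ^ 2 - (1 - cww0 z) ^ 2)) /
        (doublingRatio z * (doublingRatio z + 1)) ≤
      (2 * i3Coeff x * cww0 x ^ 2 + cww0 x * (Real.tanh x ^ 2 - (1 - cww0 x) ^ 2)) /
        (doublingRatio x * (doublingRatio x + 1)) + (z - x) := by
  have hz := hx.trans_le hxz
  have hxz2 : x ^ 2 ≤ z ^ 2 := pow_le_pow_left₀ hx.le hxz 2
  have hTx := tanh_pos hx
  have hTz1 := Real.tanh_lt_one z
  have hTm := tanh_monotone hxz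
  have hTl := tanh_sub_tanh_le hxz
  have hcz := cww0_pos hz
  have hcm := cww0_anti hx hxz
  have hcx1 := cww0_lt_one hx
  have hsx := one_le_doublingRatio x
  have hsm := doublingRatio_mono hx hxz
  have hBz := i3Coeff_nonneg hz2
  have hBm := i3Coeff_anti hxz2 hz2
  have hqz := (sub_pos.2 (sq_one_sub_cww0_lt hz)).le
  set gx := doublingRatio x * (doublingRatio x + 1) with hgx
  set gz := doublingRatio z * (doublingRatio z + 1) with hgz
  have hg2 : 2 ≤ gx := by nlinarith
  have hgm : gx ≤ gz := by
    refine mul_le_mul hsm (by linarith) (by linarith) (by linarith)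
  have hM : 2 * i3Coeff z * cww0 z ^ 2 + cww0 z * (Real.tanh z ^ 2 - (1 - cww0 z) ^ 2) ≤
      2 * i3Coeff x * cww0 x ^ 2 + cww0 x * (Real.tanh x ^ 2 - (1 - cww0 x) ^ 2) +
        2 * (z - x) := by
    have h1 : i3Coeff z * cww0 z ^ 2 ≤ i3Coeff x * cww0 x ^ 2 :=
      mul_le_mul hBm (pow_le_pow_left₀ hcz.le hcm 2) (by positivity) (hBz.trans hBm)
    have hT2 : (Real.tanh z - Real.tanh x) * (Real.tanh z + Real.tanh x) ≤ (z - x) * 2 :=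
      mul_le_mul hTl (by linarith) (by linarith) (by linarith)
    have hc2 : (1 - cww0 x) ^ 2 ≤ (1 - cww0 z) ^ 2 :=
      pow_le_pow_left₀ (by linarith) (by linarith) 2
    have h2 : Real.tanh z ^ 2 - (1 - cww0 z) ^ 2 ≤
        Real.tanh x ^ 2 - (1 - cww0 x) ^ 2 + 2 * (z - x) := by linarith
    have h4 := mul_le_mul_of_nonneg_right hcm hqz
    have h5 := mul_le_mul_of_nonneg_left h2 (hcz.le.trans hcm)
    have h6 := mul_le_mul_of_nonneg_right hcx1.le (sub_nonneg.2 hxz)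
    linarith
  have hMz : 0 ≤ 2 * i3Coeff z * cww0 z ^ 2 +
      cww0 z * (Real.tanh z ^ 2 - (1 - cww0 z) ^ 2) := by positivity
  refine (div_le_div_of_nonneg_left hMz (by linarith) hgm).trans ?_
  rw [div_add' _ _ _ (by linarith : gx ≠ 0)]
  refine div_le_div_of_nonneg_right (hM.trans ?_) (by linarith)
  have := mul_le_mul_of_nonneg_left hg2 (sub_nonneg.2 hxz)
  linarith

theorem reducedIndex_strictAnti {x z : ℝ} (hx : 0 < x) (hx2 : 3 / 2 ≤ x ^ 2) (hxz : x < z)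
    (hz2 : z ^ 2 ≤ 18 / 5) : reducedIndex z < reducedIndex x := by
  have h1 := sub_lt_i2_term_sub hx hx2 hxz hz2
  have h2 := i3_term_sub_le hx hxz.le hz2
  rw [reducedIndex, reducedIndex]
  linarith

theorem lt_and_lt_of_sq_lt_sq {x a b : ℝ} (hx : 0 < x) (hb : 0 < b) (h1 : a ^ 2 < x ^ 2)
    (h2 : x ^ 2 < b ^ 2) : a < x ∧ x < b :=
  ⟨lt_of_pow_lt_pow_left₀ 2 hx.le h1, lt_of_pow_lt_pow_left₀ 2 hb.le h2⟩

theorem reducedIndex_pos_left : 0 < reducedIndex 1.41 := by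
  have hk : (0 : ℝ) < 1.41 := by norm_num
  have hTl : 0.8874 < Real.tanh 1.41 := lt_trans (by norm_num) (pade_four_lt_tanh hk)
  have hTu : Real.tanh 1.41 < 0.8896 := (tanh_lt_pade_three hk).trans (by norm_num)
  have hc2 : Real.tanh 1.41 = 1.41 * cww0 1.41 ^ 2 := tanh_eq_mul_cww0_sq hk
  obtain ⟨hcl, hcu⟩ : 0.7933 < cww0 1.41 ∧ cww0 1.41 < 0.7944 :=
    lt_and_lt_of_sq_lt_sq (cww0_pos hk) (by norm_num) (by linarith) (by linarith)
  have hsu : doublingRatio 1.41 < 1.3385 := by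
    refine lt_of_pow_lt_pow_left₀ 2 (by norm_num) ?_
    rw [doublingRatio_sq]
    nlinarith
  have hs := one_le_doublingRatio 1.41
  have hA : i2Coeff 1.41 < 0.803 := by norm_num [i2Coeff]
  have hB : 1.647 < i3Coeff 1.41 := by norm_num [i3Coeff]
  have hp : 0.05 < ((1 - cww0 1.41) / Real.tanh 1.41) ^ 2 := by
    have : 0.23 < (1 - cww0 1.41) / Real.tanh 1.41 := by
      rw [lt_div_iff₀ (by linarith)]
      linarith
    nlinarith
  have hR : 0.84 < (2 * i3Coeff 1.41 * cww0 1.41 ^ 2 +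
      cww0 1.41 * (Real.tanh 1.41 ^ 2 - (1 - cww0 1.41) ^ 2)) /
        (doublingRatio 1.41 * (doublingRatio 1.41 + 1)) := by
    have hden : doublingRatio 1.41 * (doublingRatio 1.41 + 1) < 3.1301 := by nlinarith
    have h1 : 1.647 * 0.6293 < i3Coeff 1.41 * cww0 1.41 ^ 2 :=
      mul_lt_mul'' hB (by linarith) (by norm_num) (by norm_num)
    have h2 : 0.7933 * 0.74 < cww0 1.41 * (Real.tanh 1.41 ^ 2 - (1 - cww0 1.41) ^ 2) :=
      mul_lt_mul'' hcl (by nlinarith) (by norm_num) (by norm_num)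
    rw [lt_div_iff₀ (by positivity)]
    linarith
  have hAp : i2Coeff 1.41 * (1 - ((1 - cww0 1.41) / Real.tanh 1.41) ^ 2) ≤ 0.803 * 0.95 :=
    mul_le_mul hA.le (by linarith) (sub_pos.2 (ratio_sq_lt_one hk)).le (by norm_num)
  rw [reducedIndex]
  linarith

theorem reducedIndex_neg_right : reducedIndex 1.43 < 0 := by
  have hk : (0 : ℝ) < 1.43 := by norm_num
  have hTl : 0.8916 < Real.tanh 1.43 := lt_trans (by norm_num) (pade_four_lt_tanh hk)
  have hTu : Real.tanh 1.43 < 0.8939 := (tanh_lt_pade_three hk).trans (by norm_num)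
  have hc2 : Real.tanh 1.43 = 1.43 * cww0 1.43 ^ 2 := tanh_eq_mul_cww0_sq hk
  obtain ⟨hcl, hcu⟩ : 0.7896 < cww0 1.43 ∧ cww0 1.43 < 0.7907 :=
    lt_and_lt_of_sq_lt_sq (cww0_pos hk) (by norm_num) (by linarith) (by linarith)
  have hsl : 1.3397 < doublingRatio 1.43 := by
    have hs := one_le_doublingRatio 1.43
    refine lt_of_pow_lt_pow_left₀ 2 (by linarith) ?_
    rw [doublingRatio_sq]
    nlinarith
  have hA : 0.953 < i2Coeff 1.43 := by norm_num [i2Coeff]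
  have hB : i3Coeff 1.43 < 1.562 := by norm_num [i3Coeff]
  have hp : ((1 - cww0 1.43) / Real.tanh 1.43) ^ 2 < 0.06 := by
    have h1 : (1 - cww0 1.43) / Real.tanh 1.43 < 0.24 := by
      rw [div_lt_iff₀ (by linarith)]
      linarith
    have h0 : 0 < (1 - cww0 1.43) / Real.tanh 1.43 := div_pos (by linarith) (by linarith)
    nlinarith
  have hR : (2 * i3Coeff 1.43 * cww0 1.43 ^ 2 +
      cww0 1.43 * (Real.tanh 1.43 ^ 2 - (1 - cww0 1.43) ^ 2)) /
        (doublingRatio 1.43 * (doublingRatio 1.43 + 1)) < 0.83 := by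
    have hden : 3.134 < doublingRatio 1.43 * (doublingRatio 1.43 + 1) := by nlinarith
    have h1 : i3Coeff 1.43 * cww0 1.43 ^ 2 ≤ 1.562 * 0.6253 :=
      mul_le_mul hB.le (by linarith) (by positivity) (by norm_num)
    have h2 : cww0 1.43 * (Real.tanh 1.43 ^ 2 - (1 - cww0 1.43) ^ 2) ≤ 0.7907 * 0.757 :=
      mul_le_mul hcu.le (by nlinarith) (sub_pos.2 (sq_one_sub_cww0_lt hk)).le (by norm_num)
    rw [div_lt_iff₀ (by linarith)]
    linarith
  have hAp : 0.953 * 0.94 <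
      i2Coeff 1.43 * (1 - ((1 - cww0 1.43) / Real.tanh 1.43) ^ 2) :=
    mul_lt_mul'' hA (by linarith) (by norm_num) (by norm_num)
  rw [reducedIndex]
  linarith

theorem continuousOn_cww0 : ContinuousOn cww0 (Ioi 0) := by
  have h : ContinuousOn (fun k : ℝ => √(Real.tanh k / k)) (Ioi 0) := fun k hk =>
    (((hasDerivAt_tanh k).continuousAt.div continuousAt_id (ne_of_gt hk)).sqrt).continuousWithinAt
  exact h.congr fun k hk => cww0_of_pos hk

theorem continuousOn_reducedIndex : ContinuousOn reducedIndex (Ioi 0) := by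
  have hT : Continuous Real.tanh :=
    continuous_iff_continuousAt.2 fun x => (hasDerivAt_tanh x).continuousAt
  have hc := continuousOn_cww0
  have hs : Continuous doublingRatio := (continuous_const.add (hT.pow 2)).sqrt
  have hA : Continuous i2Coeff := by
    unfold i2Coeff
    fun_prop
  have hB : Continuous i3Coeff := by
    unfold i3Coeff
    fun_prop
  have hp : ContinuousOn (fun k => (1 - cww0 k) / Real.tanh k) (Ioi 0) :=
    (continuousOn_const.sub hc).div hT.continuousOn fun k hk => (tanh_pos hk).ne'
  refine ContinuousOn.add (by fun_prop) (ContinuousOn.div (by fun_prop) (by fun_prop) ?_)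
  intro k _
  have := one_le_doublingRatio k
  positivity

/-- `i₄` possesses a root `k_c ∈ (1.41, 1.43)`, with `i₄ > 0` on `(0, k_c)` and
`i₄ < 0` on `(k_c, ∞)`; hence a sufficiently small `2π/k`-periodic traveling wave is
modulationally unstable precisely when `k > k_c = 1.420…`. -/
theorem i4_critical_wave_number :
    ∃ kc : ℝ, kc ∈ Set.Ioo (1.41 : ℝ) 1.43 ∧ i4 kc = 0 ∧
      (∀ k : ℝ, 0 < k → k < kc → 0 < i4 k) ∧
      (∀ k : ℝ, kc < k → i4 k < 0) := by
  obtain ⟨kc, ⟨hl, hr⟩, hz⟩ : (0 : ℝ) ∈ reducedIndex '' Icc 1.41 1.43 :=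
    intermediate_value_Icc' (by norm_num)
      (continuousOn_reducedIndex.mono fun k hk => lt_of_lt_of_le (by norm_num) hk.1)
      ⟨reducedIndex_neg_right.le, reducedIndex_pos_left.le⟩
  have hl' : 1.41 < kc := lt_of_le_of_ne hl fun h => by
    have := reducedIndex_pos_left
    rw [h, hz] at this
    exact this.false
  have hr' : kc < 1.43 := lt_of_le_of_ne hr fun h => by
    have := reducedIndex_neg_right
    rw [← h, hz] at this
    exact this.false
  have hkc : 0 < kc := lt_trans (by norm_num) hl'
  refine ⟨kc, ⟨hl', hr'⟩, by rw [i4_eq hkc, hz, mul_zero], fun k hk hkkc => ?_, fun k hkck => ?_⟩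
  · rw [i4_pos_iff hk]
    rcases le_total (k ^ 2) (3 / 2) with h | h
    · exact reducedIndex_pos_of_sq_le hk h
    · rw [← hz]
      exact reducedIndex_strictAnti hk h hkkc (by nlinarith)
  · have hk := hkc.trans hkck
    rw [i4_neg_iff hk]
    rcases le_total (18 / 5) (k ^ 2) with h | h
    · exact reducedIndex_neg_of_le_sq hk h
    · rw [← hz]
      exact reducedIndex_strictAnti hkc (by nlinarith) hkck h
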